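/- arXiv:2505.09469 — 7 statements merged into one kernel-verified Lean document; each statement's English description precedes it below -/
import Mathlib

section
/- Fix integers N_x, N_y ≥ 1 and positive reals Δx, Δy, Δt, Pe_s, Pe_φ, Pe_ψ, and let E^h : ℝ^{N_x×N_y} × ℝ^{N_x×N_y} × ℝ^{N_x} → ℝ be an arbitrary function. Assume 0 ≤ ψ^k_{i,j} ≤ 1 for all 1 ≤ i ≤ N_x, 1 ≤ j ≤ N_y. If u* = (φ*, m^x_{φ*}, m^y_{φ*}, ψ*, m^x_{ψ*}, m^y_{ψ*}, φ*_bc) is admissible and satisfies J(u*) ≤ J(u) for every admissible tuple u, then (1/2) Σ_{i=1}^{N_x} Σ_{j=1}^{N_y} [ D_{M_φ}(φ*_{i,j}, ((m^x_{φ*})_{i,j}, (m^y_{φ*})_{i,j})) + D_{M_ψ}(ψ*_{i,j}, ((m^x_{ψ*})_{i,j}, (m^y_{ψ*})_{i,j})) ] Δx Δy + (Pe_s/2) Σ_{i=1}^{N_x} ((φ*_bc)_i − (φ^k_bc)_i)² Δx + Δt · E^h(φ*, ψ*, φ*_bc) ≤ Δt · E^h(φ^k, ψ^k, φ^k_bc);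 in particular E^h(φ*, ψ*, φ*_bc) ≤ E^h(φ^k, ψ^k, φ^k_bc) (discrete original energy dissipation). -/
open scoped Classical

/-- Extended-real-valued transport cost D_M(ρ, (mx, my)) = ‖m‖²/M(ρ) associated
with a mobility function M, with value 0 when M(ρ) = 0 and m = 0, and +∞
otherwise. -/
noncomputable def Dcost (M : ℝ → ℝ) (ρ mx my : ℝ) : EReal :=
  if 0 < M ρ then (((mx ^ 2 + my ^ 2) / M ρ : ℝ) : EReal)
  else if M ρ = 0 ∧ mx = 0 ∧ my = 0 then 0
  else ⊤

/-- Admissibility of a density/momentum pair: the central-difference discrete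
continuity equation holds in the interior, together with the reflected
ghost-value (no-flux) boundary conditions. -/
def Admissible (Nx Ny : ℕ) (Δx Δy : ℝ) (ρk ρ mx my : ℕ → ℕ → ℝ) : Prop :=
  (∀ i ∈ Finset.Icc 1 Nx, ∀ j ∈ Finset.Icc 1 Ny,
    ρ i j + (1 / (2 * Δx)) * (mx (i + 1) j - mx (i - 1) j)
      + (1 / (2 * Δy)) * (my i (j + 1) - my i (j - 1)) = ρk i j) ∧
  (∀ j ∈ Finset.Icc 1 Ny, mx 0 j = - mx 1 j ∧ mx (Nx + 1) j = - mx Nx j) ∧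
  (∀ i ∈ Finset.Icc 1 Nx, my i 0 = - my i 1 ∧ my i (Ny + 1) = - my i Ny)

/-- The extended-real-valued objective of the full-discrete JKO scheme for the
PFS-MCL model. -/
noncomputable def Jfun (Nx Ny : ℕ) (Δx Δy Δt Pes Peφ Peψ : ℝ)
    (Eh : (ℕ → ℕ → ℝ) → (ℕ → ℕ → ℝ) → (ℕ → ℝ) → ℝ) (φkbc : ℕ → ℝ)
    (φ mxφ myφ ψ mxψ myψ : ℕ → ℕ → ℝ) (φbc : ℕ → ℝ) : EReal :=
  ((1 / 2 : ℝ) : EReal) *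
    (∑ i ∈ Finset.Icc 1 Nx, ∑ j ∈ Finset.Icc 1 Ny,
      (Dcost (fun _ => 1 / Peφ) (φ i j) (mxφ i j) (myφ i j)
        + Dcost (fun s => s * (1 - s) / Peψ) (ψ i j) (mxψ i j) (myψ i j)))
    * ((Δx * Δy : ℝ) : EReal)
  + ((Pes / 2 * ∑ i ∈ Finset.Icc 1 Nx, (φbc i - φkbc i) ^ 2 * Δx : ℝ) : EReal)
  + ((Δt * Eh φ ψ φbc : ℝ) : EReal)

theorem Dcost_nonneg (M : ℝ → ℝ) (ρ mx my : ℝ) : 0 ≤ Dcost M ρ mx my := by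
  unfold Dcost
  split_ifs with h
  · exact EReal.coe_nonneg.mpr (by positivity)
  · exact le_rfl
  · exact le_top

theorem Dcost_zero_momentum {M : ℝ → ℝ} {ρ : ℝ} (h : 0 ≤ M ρ) : Dcost M ρ 0 0 = 0 := by
  unfold Dcost
  split_ifs with h₁ h₂
  · simp
  · rfl
  · exact absurd ⟨le_antisymm (not_lt.mp h₁) h, rfl, rfl⟩ h₂

theorem Admissible.stationary (Nx Ny : ℕ) (Δx Δy : ℝ) (ρk : ℕ → ℕ → ℝ) :
    Admissible Nx Ny Δx Δy ρk ρk (fun _ _ => 0) (fun _ _ => 0) := by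
  simp [Admissible]

/-- Discrete original energy dissipation for the full-discrete JKO scheme: any
global minimizer of the objective among admissible tuples satisfies the discrete
energy inequality, and in particular the discrete energy decreases. -/
theorem stmt_0 (Nx Ny : ℕ) (hNx : 1 ≤ Nx) (hNy : 1 ≤ Ny)
    (Δx Δy Δt Pes Peφ Peψ : ℝ)
    (hΔx : 0 < Δx) (hΔy : 0 < Δy) (hΔt : 0 < Δt)
    (hPes : 0 < Pes) (hPeφ : 0 < Peφ) (hPeψ : 0 < Peψ)
    (Eh : (ℕ → ℕ → ℝ) → (ℕ → ℕ → ℝ) → (ℕ → ℝ) → ℝ)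
    (φk ψk : ℕ → ℕ → ℝ) (φkbc : ℕ → ℝ)
    (hψk : ∀ i ∈ Finset.Icc 1 Nx, ∀ j ∈ Finset.Icc 1 Ny,
      0 ≤ ψk i j ∧ ψk i j ≤ 1)
    (φs mxφs myφs ψs mxψs myψs : ℕ → ℕ → ℝ) (φbcs : ℕ → ℝ)
    (hadmφ : Admissible Nx Ny Δx Δy φk φs mxφs myφs)
    (hadmψ : Admissible Nx Ny Δx Δy ψk ψs mxψs myψs)
    (hmin : ∀ (φ mxφ myφ ψ mxψ myψ : ℕ → ℕ → ℝ) (φbc : ℕ → ℝ),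
      Admissible Nx Ny Δx Δy φk φ mxφ myφ →
      Admissible Nx Ny Δx Δy ψk ψ mxψ myψ →
      Jfun Nx Ny Δx Δy Δt Pes Peφ Peψ Eh φkbc φs mxφs myφs ψs mxψs myψs φbcs ≤
        Jfun Nx Ny Δx Δy Δt Pes Peφ Peψ Eh φkbc φ mxφ myφ ψ mxψ myψ φbc) :
    Jfun Nx Ny Δx Δy Δt Pes Peφ Peψ Eh φkbc φs mxφs myφs ψs mxψs myψs φbcs ≤
        ((Δt * Eh φk ψk φkbc : ℝ) : EReal) ∧
      Eh φs ψs φbcs ≤ Eh φk ψk φkbc := by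
  have hJk : Jfun Nx Ny Δx Δy Δt Pes Peφ Peψ Eh φkbc φk (fun _ _ => 0) (fun _ _ => 0)
      ψk (fun _ _ => 0) (fun _ _ => 0) φkbc = ((Δt * Eh φk ψk φkbc : ℝ) : EReal) := by
    have hsum : (∑ i ∈ Finset.Icc 1 Nx, ∑ j ∈ Finset.Icc 1 Ny,
        (Dcost (fun _ => 1 / Peφ) (φk i j) 0 0
          + Dcost (fun s => s * (1 - s) / Peψ) (ψk i j) 0 0)) = 0 := by
      refine Finset.sum_eq_zero fun i hi => Finset.sum_eq_zero fun j hj => ?_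
      obtain ⟨h0, h1⟩ := hψk i hi j hj
      rw [Dcost_zero_momentum (by positivity),
        Dcost_zero_momentum (by exact div_nonneg (mul_nonneg h0 (sub_nonneg.mpr h1)) hPeψ.le),
        add_zero]
    simp only [Jfun, hsum]
    simp
  have hle := hmin φk (fun _ _ => 0) (fun _ _ => 0) ψk (fun _ _ => 0) (fun _ _ => 0) φkbc
    (Admissible.stationary ..) (Admissible.stationary ..)
  rw [hJk] at hle
  refine ⟨hle, ?_⟩
  have hEJ : ((Δt * Eh φs ψs φbcs : ℝ) : EReal) ≤
      Jfun Nx Ny Δx Δy Δt Pes Peφ Peψ Eh φkbc φs mxφs myφs ψs mxψs myψs φbcs := by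
    refine le_add_of_nonneg_left (add_nonneg (mul_nonneg (mul_nonneg ?_ ?_) ?_) ?_)
    · exact EReal.coe_nonneg.mpr (by norm_num)
    · exact Finset.sum_nonneg fun i _ => Finset.sum_nonneg fun j _ =>
        add_nonneg (Dcost_nonneg ..) (Dcost_nonneg ..)
    · exact EReal.coe_nonneg.mpr (by positivity)
    · exact EReal.coe_nonneg.mpr (by positivity)
  exact le_of_mul_le_mul_left (EReal.coe_le_coe_iff.mp (hEJ.trans hle)) hΔt
end

section
/- Fix integers N_x, N_y ≥ 1 and positive reals Δx, Δy. Let ρ, ρ^k : {1,…,N_x}×{1,…,N_y} → ℝ and m^x, m^y : {0,…,N_x+1}×{0,…,N_y+1} → ℝ satisfy, for all 1 ≤ i ≤ N_x and 1 ≤ j ≤ N_y, the discrete continuity equation ρ_{i,j} + (1/(2Δx))(m^x_{i+1,j} − m^x_{i−1,j}) + (1/(2Δy))(m^y_{i,j+1} − m^y_{i,j−1}) = ρ^k_{i,j}, together with the ghost-value (no-flux) conditions m^x_{0,j} = −m^x_{1,j} and m^x_{N_x+1,j} = −m^x_{N_x,j} for all 1 ≤ j ≤ N_y, and m^y_{i,0}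 = −m^y_{i,1} and m^y_{i,N_y+1} = −m^y_{i,N_y} for all 1 ≤ i ≤ N_x. Then the total mass is conserved: Σ_{i=1}^{N_x} Σ_{j=1}^{N_y} ρ_{i,j} = Σ_{i=1}^{N_x} Σ_{j=1}^{N_y} ρ^k_{i,j}. -/
/-- The central differences of a sequence telescope to its boundary values. -/
theorem sum_Icc_central_difference (f : ℕ → ℝ) (n : ℕ) :
    ∑ i ∈ Finset.Icc 1 n, (f (i + 1) - f (i - 1)) = f (n + 1) + f n - f 1 - f 0 := by
  induction n with
  | zero => simp
  | succ n ih =>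
    rw [Finset.sum_Icc_succ_top (by omega), ih, Nat.add_sub_cancel]
    ring

/-- Central differences sum to zero when the ghost values are odd reflections. -/
theorem sum_Icc_central_difference_eq_zero (f : ℕ → ℝ) (n : ℕ)
    (h : f 0 = -f 1 ∧ f (n + 1) = -f n) :
    ∑ i ∈ Finset.Icc 1 n, (f (i + 1) - f (i - 1)) = 0 := by
  rw [sum_Icc_central_difference, h.1, h.2]
  ring

/-- Discrete mass conservation for the central-difference discretization of the
continuity equation with reflected ghost values (no-flux boundary conditions). -/
theorem stmt_1 (Nx Ny : ℕ) (hNx : 1 ≤ Nx) (hNy : 1 ≤ Ny)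
    (Δx Δy : ℝ) (hΔx : 0 < Δx) (hΔy : 0 < Δy)
    (ρ ρk : ℕ → ℕ → ℝ) (mx my : ℕ → ℕ → ℝ)
    (hcont : ∀ i ∈ Finset.Icc 1 Nx, ∀ j ∈ Finset.Icc 1 Ny,
      ρ i j + (1 / (2 * Δx)) * (mx (i + 1) j - mx (i - 1) j)
        + (1 / (2 * Δy)) * (my i (j + 1) - my i (j - 1)) = ρk i j)
    (hghostx : ∀ j ∈ Finset.Icc 1 Ny,
      mx 0 j = - mx 1 j ∧ mx (Nx + 1) j = - mx Nx j)
    (hghosty : ∀ i ∈ Finset.Icc 1 Nx,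
      my i 0 = - my i 1 ∧ my i (Ny + 1) = - my i Ny) :
    ∑ i ∈ Finset.Icc 1 Nx, ∑ j ∈ Finset.Icc 1 Ny, ρ i j
      = ∑ i ∈ Finset.Icc 1 Nx, ∑ j ∈ Finset.Icc 1 Ny, ρk i j := by
  have hx : ∑ i ∈ Finset.Icc 1 Nx, ∑ j ∈ Finset.Icc 1 Ny,
      (1 / (2 * Δx)) * (mx (i + 1) j - mx (i - 1) j) = 0 := by
    rw [Finset.sum_comm]
    refine Finset.sum_eq_zero fun j hj => ?_
    rw [← Finset.mul_sum,
      sum_Icc_central_difference_eq_zero (fun i => mx i j) Nx (hghostx j hj), mul_zero]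
  have hy : ∑ i ∈ Finset.Icc 1 Nx, ∑ j ∈ Finset.Icc 1 Ny,
      (1 / (2 * Δy)) * (my i (j + 1) - my i (j - 1)) = 0 := by
    refine Finset.sum_eq_zero fun i hi => ?_
    rw [← Finset.mul_sum,
      sum_Icc_central_difference_eq_zero (my i) Ny (hghosty i hi), mul_zero]
  rw [← Finset.sum_congr rfl fun i hi => Finset.sum_congr rfl (hcont i hi)]
  simp only [Finset.sum_add_distrib, hx, hy, add_zero]
end

section
/- Let N_x, N_y ≥ 2 be integers and Δx, Δy > 0. Define the (N_x N_y)×(N_x N_y) matrix B = I + (1/(4Δx²)) (I_{N_y} ⊗ (D_{N_x} D_{N_x}ᵀ)) + (1/(4Δy²)) ((D_{N_y} D_{N_y}ᵀ) ⊗ I_{N_x}), where ⊗ is the Kronecker product and I denotes identity matrices of the indicated sizes. Then for all integers 1 ≤ m ≤ N_x and 1 ≤ n ≤ N_y, the vector v indexed by pairs (j, i) with 1 ≤ j ≤ N_y, 1 ≤ i ≤ N_x and entries v_{(j,i)} = cos(π(j − 1/2)(n − 1)/N_y) · cos(π(i − 1/2)(m − 1)/N_x) is nonzero and satisfies B v =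 λ_{mn} v with λ_{mn} = 1 + (1/(2Δx²))(1 − cos(2π(m − 1)/N_x)) + (1/(2Δy²))(1 − cos(2π(n − 1)/N_y)). -/
open Real Matrix Kronecker

/-- The n×n central-difference matrix Dₙ with reflected ghost values (rows and
columns 0-indexed here, corresponding to indices 1,…,n in the paper). -/
def Dmat (n : ℕ) : Matrix (Fin n) (Fin n) ℝ :=
  Matrix.of fun i j =>
    if (i : ℕ) = 0 ∧ (j : ℕ) = 0 then 1
    else if (j : ℕ) = (i : ℕ) + 1 then 1
    else if (j : ℕ) + 1 = (i : ℕ) then -1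
    else if (i : ℕ) = n - 1 ∧ (j : ℕ) = n - 1 then -1
    else 0

lemma sum_fin_ite_intCast_eq (n : ℕ) (k : ℤ) (f : ℤ → ℝ) :
    ∑ j : Fin n, (if ((j : ℕ) : ℤ) = k then f (j : ℕ) else 0) =
      if 0 ≤ k ∧ k < n then f k else 0 := by
  split_ifs with h
  · lift k to ℕ using h.1
    rw [Finset.sum_eq_single (⟨k, by omega⟩ : Fin n)]
    · simp
    · intro j _ hj
      rw [if_neg]
      intro hk
      exact hj (Fin.ext (by simpa using hk))
    · simp
  · refine Finset.sum_eq_zero fun j _ => if_neg ?_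
    have := j.isLt
    omega

/-- `Dmat` acts as a central difference on sequences that are odd about both walls. -/
lemma Dmat_mulVec_of_odd {n : ℕ} (hn : 2 ≤ n) (f : ℤ → ℝ)
    (h0 : f (-1) = -f 0) (h1 : f n = -f (n - 1)) (i : Fin n) :
    (Dmat n *ᵥ fun j => f (j : ℕ)) i = f ((i : ℕ) + 1) - f ((i : ℕ) - 1) := by
  have hi := i.isLt
  have key : ∀ j : Fin n, Dmat n i j * f (j : ℕ) =
      (if ((j : ℕ) : ℤ) = (i : ℕ) + 1 then f (j : ℕ) else 0)
      - (if ((j : ℕ) : ℤ) = (i : ℕ) - 1 then f (j : ℕ) else 0)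
      + (if (i : ℕ) = 0 then (if ((j : ℕ) : ℤ) = 0 then f (j : ℕ) else 0) else 0)
      - (if (i : ℕ) = n - 1 then
          (if ((j : ℕ) : ℤ) = n - 1 then f (j : ℕ) else 0) else 0) := by
    intro j
    have hj := j.isLt
    simp only [Dmat, Matrix.of_apply]
    split_ifs <;> first | omega | simp
  simp only [mulVec, dotProduct, key, Finset.sum_add_distrib, Finset.sum_sub_distrib]
  rw [sum_fin_ite_intCast_eq, sum_fin_ite_intCast_eq]
  by_cases hz : (i : ℕ) = 0
  · have hl : ¬ (0 = n - 1) := by omega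
    simp only [hz, hl, if_true, if_false, Finset.sum_const_zero]
    rw [sum_fin_ite_intCast_eq, if_pos (by omega), if_neg (by omega), if_pos (by omega)]
    simp [h0]
  · by_cases hl : (i : ℕ) = n - 1
    · have e : ((i : ℕ) : ℤ) = n - 1 := by omega
      have hn1 : n - 1 ≠ 0 := by omega
      simp only [hl, hn1, if_true, if_false, Finset.sum_const_zero]
      rw [sum_fin_ite_intCast_eq, ← hl, e, if_neg (by omega), if_pos (by omega),
        if_pos (by omega)]
      rw [show (n : ℤ) - 1 + 1 = n by ring, h1]
      ring
    · simp only [hz, hl, if_false, Finset.sum_const_zero]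
      rw [if_pos (by omega), if_pos (by omega)]
      ring

/-- The transpose of `Dmat` acts as a backward central difference on sequences that are even
about both walls. -/
lemma Dmat_transpose_mulVec_of_even {n : ℕ} (hn : 2 ≤ n) (f : ℤ → ℝ)
    (h0 : f (-1) = f 0) (h1 : f n = f (n - 1)) (i : Fin n) :
    ((Dmat n)ᵀ *ᵥ fun j => f (j : ℕ)) i = f ((i : ℕ) - 1) - f ((i : ℕ) + 1) := by
  have hi := i.isLt
  have key : ∀ j : Fin n, (Dmat n)ᵀ i j * f (j : ℕ) =
      (if ((j : ℕ) : ℤ) = (i : ℕ) - 1 then f (j : ℕ) else 0)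
      - (if ((j : ℕ) : ℤ) = (i : ℕ) + 1 then f (j : ℕ) else 0)
      + (if (i : ℕ) = 0 then (if ((j : ℕ) : ℤ) = 0 then f (j : ℕ) else 0) else 0)
      - (if (i : ℕ) = n - 1 then
          (if ((j : ℕ) : ℤ) = n - 1 then f (j : ℕ) else 0) else 0) := by
    intro j
    have hj := j.isLt
    simp only [Dmat, Matrix.transpose_apply, Matrix.of_apply]
    split_ifs <;> first | omega | simp
  simp only [mulVec, dotProduct, key, Finset.sum_add_distrib, Finset.sum_sub_distrib]
  rw [sum_fin_ite_intCast_eq, sum_fin_ite_intCast_eq]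
  by_cases hz : (i : ℕ) = 0
  · have hl : ¬ (0 = n - 1) := by omega
    simp only [hz, hl, if_true, if_false, Finset.sum_const_zero]
    rw [sum_fin_ite_intCast_eq, if_neg (by omega), if_pos (by omega), if_pos (by omega)]
    simp [h0]
    ring
  · by_cases hl : (i : ℕ) = n - 1
    · have e : ((i : ℕ) : ℤ) = n - 1 := by omega
      have hn1 : n - 1 ≠ 0 := by omega
      simp only [hl, hn1, if_true, if_false, Finset.sum_const_zero]
      rw [sum_fin_ite_intCast_eq, ← hl, e, if_pos (by omega), if_neg (by omega),
        if_pos (by omega)]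
      rw [show (n : ℤ) - 1 + 1 = n by ring, h1]
      ring
    · simp only [hz, hl, if_false, Finset.sum_const_zero]
      rw [if_pos (by omega), if_pos (by omega)]
      ring

/-- The discrete-cosine vectors are eigenvectors of `Dmat n * (Dmat n)ᵀ`. -/
lemma Dmat_mul_transpose_mulVec_cos {n : ℕ} (hn : 2 ≤ n) (k : ℤ) :
    (Dmat n * (Dmat n)ᵀ) *ᵥ (fun i : Fin n => cos (π * ((i : ℕ) + 1 / 2) * k / n)) =
      (2 * (1 - cos (2 * π * k / n))) •
        fun i : Fin n => cos (π * ((i : ℕ) + 1 / 2) * k / n) := by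
  obtain ⟨θ, hθ⟩ : ∃ θ : ℝ, θ = π * k / n := ⟨_, rfl⟩
  have hn0 : (n : ℝ) ≠ 0 := by positivity
  have hnθ : n * θ = k * π := by rw [hθ]; field_simp
  have hsin : sin (n * θ) = 0 := by rw [hnθ]; exact sin_int_mul_pi k
  have hv : (fun i : Fin n => cos (π * ((i : ℕ) + 1 / 2) * k / n)) =
      fun i : Fin n => (fun z : ℤ => cos (((z : ℝ) + 1 / 2) * θ)) (i : ℕ) := by
    funext i
    simp only [hθ, Int.cast_natCast]
    congr 1
    ring
  have hs : (Dmat n)ᵀ *ᵥ (fun i : Fin n => (fun z : ℤ => cos (((z : ℝ) + 1 / 2) * θ)) (i : ℕ)) =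
      fun i : Fin n =>
        (fun z : ℤ => 2 * sin θ * sin (((z : ℝ) + 1 / 2) * θ)) (i : ℕ) := by
    funext i
    rw [Dmat_transpose_mulVec_of_even hn (fun z : ℤ => cos (((z : ℝ) + 1 / 2) * θ))]
    · push_cast
      rw [show ((i : ℕ) - 1 + 1 / 2 : ℝ) * θ = ((i : ℕ) + 1 / 2) * θ - θ by ring,
        show ((i : ℕ) + 1 + 1 / 2 : ℝ) * θ = ((i : ℕ) + 1 / 2) * θ + θ by ring,
        cos_sub, cos_add]
      ring
    · push_cast
      rw [← cos_neg]
      congr 1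
      ring
    · push_cast
      rw [show ((n : ℝ) + 1 / 2) * θ = n * θ + θ / 2 by ring,
        show ((n : ℝ) - 1 + 1 / 2) * θ = n * θ - θ / 2 by ring, cos_sub, cos_add, hsin]
      ring
  rw [hv, ← mulVec_mulVec, hs]
  funext i
  rw [Dmat_mulVec_of_odd hn (fun z : ℤ => 2 * sin θ * sin (((z : ℝ) + 1 / 2) * θ))]
  · have h2 : 2 * π * k / n = 2 * θ := by rw [hθ]; ring
    simp only [Pi.smul_apply, smul_eq_mul]
    push_cast
    rw [show ((i : ℕ) - 1 + 1 / 2 : ℝ) * θ = ((i : ℕ) + 1 / 2) * θ - θ by ring,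
      show ((i : ℕ) + 1 + 1 / 2 : ℝ) * θ = ((i : ℕ) + 1 / 2) * θ + θ by ring,
      sin_sub, sin_add, h2, cos_two_mul, cos_sq']
    ring
  · push_cast
    rw [show ((-1 : ℝ) + 1 / 2) * θ = -((0 + 1 / 2) * θ) by ring, sin_neg]
    ring
  · push_cast
    rw [show ((n : ℝ) + 1 / 2) * θ = n * θ + θ / 2 by ring,
      show ((n : ℝ) - 1 + 1 / 2) * θ = n * θ - θ / 2 by ring, sin_sub, sin_add, hsin]
    ring

lemma kronecker_mulVec_mul {α β : Type*} [Fintype α] [Fintype β]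
    (P : Matrix α α ℝ) (Q : Matrix β β ℝ) (a : α → ℝ) (b : β → ℝ) :
    (P ⊗ₖ Q) *ᵥ (fun p => a p.1 * b p.2) = fun p => (P *ᵥ a) p.1 * (Q *ᵥ b) p.2 := by
  funext p
  simp only [mulVec, dotProduct, kroneckerMap_apply, Fintype.sum_prod_type,
    Finset.sum_mul_sum]
  exact Finset.sum_congr rfl fun _ _ => Finset.sum_congr rfl fun _ _ => by ring

lemma cos_half_mul_div_pos {N m : ℕ} (hm : 1 ≤ m) (hmN : m ≤ N) :
    0 < cos (π * (((0 : ℕ) : ℝ) + 1 / 2) * ((m : ℝ) - 1) / N) := by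
  have hm' : (1 : ℝ) ≤ m := by exact_mod_cast hm
  have hmN' : (m : ℝ) ≤ N := by exact_mod_cast hmN
  have hN : (0 : ℝ) < N := by linarith
  have hlt : ((m : ℝ) - 1) / N < 1 := by rw [div_lt_one hN]; linarith
  have hnn : 0 ≤ ((m : ℝ) - 1) / N := div_nonneg (by linarith) hN.le
  have e : π * (((0 : ℕ) : ℝ) + 1 / 2) * ((m : ℝ) - 1) / N =
      π / 2 * (((m : ℝ) - 1) / N) := by
    push_cast
    ring
  rw [e]
  apply cos_pos_of_mem_Ioo
  constructor <;> nlinarith [pi_pos]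

/-- The two-dimensional discrete-cosine vectors are eigenvectors of the matrix
B = I + (1/(4Δx²)) I ⊗ (D Dᵀ) + (1/(4Δy²)) (D Dᵀ) ⊗ I with the stated
eigenvalues, underlying the FFT-based inversion in the preconditioned
primal-dual method. -/
theorem stmt_9 (Nx Ny : ℕ) (hNx : 2 ≤ Nx) (hNy : 2 ≤ Ny)
    (Δx Δy : ℝ) (hΔx : 0 < Δx) (hΔy : 0 < Δy)
    (m n : ℕ) (hm1 : 1 ≤ m) (hmNx : m ≤ Nx) (hn1 : 1 ≤ n) (hnNy : n ≤ Ny) :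
    let B : Matrix (Fin Ny × Fin Nx) (Fin Ny × Fin Nx) ℝ :=
      1 + (1 / (4 * Δx ^ 2)) •
            ((1 : Matrix (Fin Ny) (Fin Ny) ℝ) ⊗ₖ (Dmat Nx * (Dmat Nx)ᵀ))
        + (1 / (4 * Δy ^ 2)) •
            ((Dmat Ny * (Dmat Ny)ᵀ) ⊗ₖ (1 : Matrix (Fin Nx) (Fin Nx) ℝ))
    let v : Fin Ny × Fin Nx → ℝ := fun p =>
      Real.cos (π * ((p.1 : ℕ) + 1 / 2) * ((n : ℝ) - 1) / Ny) *
        Real.cos (π * ((p.2 : ℕ) + 1 / 2) * ((m : ℝ) - 1) / Nx)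
    let lam : ℝ :=
      1 + (1 / (2 * Δx ^ 2)) * (1 - Real.cos (2 * π * ((m : ℝ) - 1) / Nx))
        + (1 / (2 * Δy ^ 2)) * (1 - Real.cos (2 * π * ((n : ℝ) - 1) / Ny))
    v ≠ 0 ∧ B.mulVec v = lam • v := by
  intro B v lam
  refine ⟨fun h => ?_, ?_⟩
  · have h0 := congrFun h (⟨0, by omega⟩, ⟨0, by omega⟩)
    exact (mul_pos (cos_half_mul_div_pos hn1 hnNy) (cos_half_mul_div_pos hm1 hmNx)).ne' h0
  · have hx := Dmat_mul_transpose_mulVec_cos hNx ((m : ℤ) - 1)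
    have hy := Dmat_mul_transpose_mulVec_cos hNy ((n : ℤ) - 1)
    push_cast at hx hy
    simp only [B, v, lam, add_mulVec, smul_mulVec, one_mulVec]
    rw [kronecker_mulVec_mul 1 _ (fun j : Fin Ny => cos (π * ((j : ℕ) + 1 / 2) * ((n : ℝ) - 1) / Ny))
        (fun i : Fin Nx => cos (π * ((i : ℕ) + 1 / 2) * ((m : ℝ) - 1) / Nx)),
      kronecker_mulVec_mul _ 1 (fun j : Fin Ny => cos (π * ((j : ℕ) + 1 / 2) * ((n : ℝ) - 1) / Ny))
        (fun i : Fin Nx => cos (π * ((i : ℕ) + 1 / 2) * ((m : ℝ) - 1) / Nx)), hx, hy]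
    funext p
    simp only [one_mulVec, Pi.add_apply, Pi.smul_apply, smul_eq_mul]
    field_simp
    ring
end

section
/- Let Cn > 0 and Δy be reals with 0 < Δy ≤ Cn, let θ_s ∈ ℝ and φ₁ ∈ ℝ. Set α = −(√2 π cos(θ_s) Δy)/(12 Cn) and define f : ℝ → ℝ by f(X) = φ₁ − X − α cos(πX/2). Then f has exactly one real root X*, and this root satisfies −|φ₁| − |α| ≤ X* ≤ |φ₁| + |α|. -/
open Real

theorem abs_mul_cos_le (α t : ℝ) : |α * Real.cos t| ≤ |α| := by
  rw [abs_mul]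
  exact mul_le_of_le_one_right (abs_nonneg α) (Real.abs_cos_le_one t)

theorem root_mem_Icc {α φ X : ℝ} (hX : φ - X - α * Real.cos (π * X / 2) = 0) :
    -|φ| - |α| ≤ X ∧ X ≤ |φ| + |α| := by
  have hcos := abs_le.mp (abs_mul_cos_le α (π * X / 2))
  have hφ := abs_le.mp (le_refl |φ|)
  constructor <;> linarith [hcos.1, hcos.2, hφ.1, hφ.2]

theorem exists_root (α φ : ℝ) : ∃ X : ℝ, φ - X - α * Real.cos (π * X / 2) = 0 := by
  have hcont : Continuous fun X : ℝ => φ - X - α * Real.cos (π * X / 2) := by fun_prop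
  have hφ := abs_le.mp (le_refl |φ|)
  refine mem_range_of_exists_le_of_exists_ge hcont ⟨|φ| + |α|, ?_⟩ ⟨-|φ| - |α|, ?_⟩
  · linarith [(abs_le.mp (abs_mul_cos_le α (π * (|φ| + |α|) / 2))).1, hφ.2]
  · linarith [(abs_le.mp (abs_mul_cos_le α (π * (-|φ| - |α|) / 2))).2, hφ.1]

theorem root_unique {α φ X Y : ℝ} (hα : |α| * (π / 2) < 1)
    (hX : φ - X - α * Real.cos (π * X / 2) = 0)
    (hY : φ - Y - α * Real.cos (π * Y / 2) = 0) : X = Y := by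
  by_contra hne
  have hpos : 0 < |X - Y| := abs_pos.mpr (sub_ne_zero.mpr hne)
  have hlt : |X - Y| < |X - Y| :=
    calc |X - Y| = |α| * |Real.cos (π * Y / 2) - Real.cos (π * X / 2)| := by
          rw [← abs_mul]
          congr 1
          linarith
      _ ≤ |α| * |π * Y / 2 - π * X / 2| :=
          mul_le_mul_of_nonneg_left (Real.abs_cos_sub_cos_le _ _) (abs_nonneg α)
      _ = |α| * (π / 2) * |X - Y| := by
          rw [show π * Y / 2 - π * X / 2 = π / 2 * (Y - X) by ring, abs_mul,
            abs_of_pos Real.pi_div_two_pos, abs_sub_comm Y X, mul_assoc]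
      _ < |X - Y| := mul_lt_of_lt_one_left hpos hα
  exact lt_irrefl _ hlt

theorem abs_wetting_coeff_le {Cn Δy : ℝ} (hCn : 0 < Cn) (hΔy : 0 < Δy) (hle : Δy ≤ Cn)
    (θs : ℝ) : |-(Real.sqrt 2 * π * Real.cos θs * Δy) / (12 * Cn)| ≤ Real.sqrt 2 * π / 12 := by
  have hcos := Real.abs_cos_le_one θs
  rw [abs_div, abs_neg, abs_mul, abs_mul, abs_of_pos hΔy,
    abs_of_pos (show 0 < 12 * Cn by positivity),
    abs_of_pos (show 0 < Real.sqrt 2 * π by positivity), div_le_iff₀ (by positivity)]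
  calc Real.sqrt 2 * π * |Real.cos θs| * Δy ≤ Real.sqrt 2 * π * 1 * Cn := by gcongr
    _ = Real.sqrt 2 * π / 12 * (12 * Cn) := by ring

theorem sqrt_two_mul_pi_div_twelve_mul_lt_one : Real.sqrt 2 * π / 12 * (π / 2) < 1 := by
  have hsqrt : Real.sqrt 2 < 3 / 2 := by
    rw [Real.sqrt_lt' (by norm_num)]
    norm_num
  have hpi : π * π < 16 := by nlinarith [Real.pi_lt_four, Real.pi_pos]
  nlinarith [Real.sqrt_nonneg 2, mul_pos Real.pi_pos Real.pi_pos]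

/-- The function from the discretized equilibrium wetting boundary condition has a
unique real root, which lies in the interval [-|φ₁| - |α|, |φ₁| + |α|]. -/
theorem stmt_11 (Cn Δy : ℝ) (hCn : 0 < Cn) (hΔy : 0 < Δy) (hle : Δy ≤ Cn)
    (θs φ₁ : ℝ) :
    let α := -(Real.sqrt 2 * π * Real.cos θs * Δy) / (12 * Cn)
    let f : ℝ → ℝ := fun X => φ₁ - X - α * Real.cos (π * X / 2)
    (∃! X : ℝ, f X = 0) ∧
      ∀ X : ℝ, f X = 0 → -|φ₁| - |α| ≤ X ∧ X ≤ |φ₁| + |α| := by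
  intro α f
  have hα : |α| * (π / 2) < 1 :=
    (mul_le_mul_of_nonneg_right (abs_wetting_coeff_le hCn hΔy hle θs)
      Real.pi_div_two_pos.le).trans_lt sqrt_two_mul_pi_div_twelve_mul_lt_one
  obtain ⟨X, hX⟩ := exists_root α φ₁
  exact ⟨⟨X, hX, fun Y hY => root_unique hα hY hX⟩, fun Y hY => root_mem_Icc hY⟩
end

section
/- Let Cn > 0 and Δy be reals with 0 < Δy ≤ Cn, let θ_s ∈ ℝ and φ₁ ∈ ℝ with −1 ≤ φ₁ ≤ 1. Set α = −(√2 π cos(θ_s) Δy)/(12 Cn) and define f : ℝ → ℝ by f(X) = φ₁ − X − α cos(πX/2). If X* ∈ ℝ satisfies f(X*) = 0, then −1 ≤ X* ≤ 1. -/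
open Real

/-- The discretized boundary value does not exceed `1` when the interior value does not. -/
lemma le_one_of_sub_eq_mul_cos {a φ X : ℝ} (ha : |a| ≤ 1 / 2) (hφ : φ ≤ 1)
    (h : φ - X = a * Real.cos (π * X / 2)) : X ≤ 1 := by
  by_contra! hX
  have hcos : Real.cos (π * X / 2) = -Real.sin (π / 2 * (X - 1)) := by
    rw [← Real.cos_add_pi_div_two]
    congr 1
    ring
  have hpos : 0 < π / 2 * (X - 1) := mul_pos (by positivity) (by linarith)
  have hsin : |Real.cos (π * X / 2)| ≤ π / 2 * (X - 1) := by
    rw [hcos, abs_neg]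
    exact Real.abs_sin_le_abs.trans_eq (abs_of_pos hpos)
  have hprod : |φ - X| ≤ 1 / 2 * (π / 2 * (X - 1)) := by
    rw [h, abs_mul]
    gcongr
  have hlt := mul_lt_mul_of_pos_right Real.pi_lt_four (sub_pos.mpr hX)
  linarith [neg_abs_le (φ - X)]

lemma abs_wetting_coeff_le_half {Cn Δy : ℝ} (hCn : 0 < Cn) (hΔy : 0 < Δy) (hle : Δy ≤ Cn)
    (θs : ℝ) : |-(Real.sqrt 2 * π * Real.cos θs * Δy) / (12 * Cn)| ≤ 1 / 2 := by
  have hsqrt : Real.sqrt 2 ≤ 3 / 2 := Real.sqrt_le_iff.mpr (by norm_num)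
  rw [abs_div, abs_neg, abs_mul, abs_mul, abs_of_pos hΔy,
    abs_of_pos (by positivity : 0 < Real.sqrt 2 * π), abs_of_pos (by positivity : 0 < 12 * Cn),
    div_le_iff₀ (by positivity)]
  calc Real.sqrt 2 * π * |Real.cos θs| * Δy ≤ 3 / 2 * 4 * 1 * Cn := by
        gcongr
        · exact Real.pi_le_four
        · exact Real.abs_cos_le_one θs
    _ = 1 / 2 * (12 * Cn) := by ring

/-- If -1 ≤ φ₁ ≤ 1, any root of the discretized equilibrium wetting boundary
condition lies in [-1, 1]. -/
theorem stmt_12 (Cn Δy : ℝ) (hCn : 0 < Cn) (hΔy : 0 < Δy) (hle : Δy ≤ Cn)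
    (θs φ₁ : ℝ) (hφ₁ : -1 ≤ φ₁ ∧ φ₁ ≤ 1) :
    let α := -(Real.sqrt 2 * π * Real.cos θs * Δy) / (12 * Cn)
    let f : ℝ → ℝ := fun X => φ₁ - X - α * Real.cos (π * X / 2)
    ∀ X : ℝ, f X = 0 → -1 ≤ X ∧ X ≤ 1 := by
  intro α f X hX
  have hα : |α| ≤ 1 / 2 := abs_wetting_coeff_le_half hCn hΔy hle θs
  have h : φ₁ - X = α * Real.cos (π * X / 2) := sub_eq_zero.mp hX
  refine ⟨neg_le.mp ?_, le_one_of_sub_eq_mul_cos hα hφ₁.2 h⟩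
  refine le_one_of_sub_eq_mul_cos (a := -α) (by rwa [abs_neg]) (neg_le.mp hφ₁.1) ?_
  rw [mul_neg, neg_div, Real.cos_neg]
  linarith
end

section
/- Let λ > 0, d ≥ 1 an integer, ψ ∈ ℝ, m ∈ ℝ^d, and M(s) = s(1−s). Define F : (0,1) × ℝ^d → ℝ by F(s, y) = (1/2)(s − ψ)² + (1/2)‖y − m‖² + λ‖y‖²/(2M(s)). If (s*, y*) with 0 < s* < 1 is a local minimizer of F, then y* = M(s*) m / (M(s*) + λ) and (s* − ψ)(λ + M(s*))² = (λ/2)(1 − 2s*)‖m‖². -/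
/-- The squared norm along a line has derivative twice the inner product of base point and
direction. -/
theorem hasDerivAt_norm_sq_add_smul {E : Type*} [NormedAddCommGroup E] [InnerProductSpace ℝ E]
    (a v : E) : HasDerivAt (fun t : ℝ => ‖a + t • v‖ ^ 2) (2 * inner ℝ a v) 0 := by
  simpa using (((hasDerivAt_id' (0 : ℝ)).smul_const v).const_add a).norm_sq

/-- First-order optimality conditions for the interior case of the proximal operator
of the transport cost with degenerate mobility M(s) = s(1-s): a local minimizer
(s*, y*) of F on (0,1) × ℝ^d satisfies y* = M(s*) m/(M(s*)+λ) and the polynomial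
equation (s* - ψ)(λ + M(s*))² = (λ/2)(1 - 2s*)‖m‖². -/
theorem stmt_15 (lam : ℝ) (hlam : 0 < lam) (d : ℕ) (hd : 1 ≤ d)
    (ψ : ℝ) (m : EuclideanSpace ℝ (Fin d)) :
    let M : ℝ → ℝ := fun s => s * (1 - s)
    let F : ℝ × EuclideanSpace ℝ (Fin d) → ℝ := fun p =>
      (1 / 2) * (p.1 - ψ) ^ 2 + (1 / 2) * ‖p.2 - m‖ ^ 2
        + lam * ‖p.2‖ ^ 2 / (2 * M p.1)
    ∀ sstar : ℝ, ∀ ystar : EuclideanSpace ℝ (Fin d),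
      0 < sstar → sstar < 1 →
      IsLocalMinOn F {p : ℝ × EuclideanSpace ℝ (Fin d) | 0 < p.1 ∧ p.1 < 1}
        (sstar, ystar) →
      ystar = (M sstar / (M sstar + lam)) • m ∧
        (sstar - ψ) * (lam + M sstar) ^ 2 = (lam / 2) * (1 - 2 * sstar) * ‖m‖ ^ 2 := by
  intro M F s y hs0 hs1 hmin
  have hM : 0 < M s := mul_pos hs0 (by linarith)
  have hopen : IsOpen {p : ℝ × EuclideanSpace ℝ (Fin d) | 0 < p.1 ∧ p.1 < 1} :=
    (isOpen_lt continuous_const continuous_fst).inter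
      (isOpen_lt continuous_fst continuous_const)
  have hloc : IsLocalMin F (s, y) := hmin.isLocalMin (hopen.mem_nhds ⟨hs0, hs1⟩)
  have hy : y = (M s / (M s + lam)) • m := by
    set w := (y - m) + (lam / M s) • y with hw
    have hmin_y : IsLocalMin (fun t : ℝ => F (s, y + t • w)) 0 := by
      refine IsLocalMin.comp_continuous (f := F) (g := fun t : ℝ => (s, y + t • w)) (b := 0) ?_ ?_
      · simpa using hloc
      · fun_prop
    have hderiv : HasDerivAt (fun t : ℝ => F (s, y + t • w))
        ((1 / 2) * (2 * inner ℝ (y - m) w) + lam * (2 * inner ℝ y w) / (2 * M s)) 0 := by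
      have h₁ := (hasDerivAt_norm_sq_add_smul (y - m) w).const_mul (1 / 2)
      have h₂ := ((hasDerivAt_norm_sq_add_smul y w).const_mul lam).div_const (2 * M s)
      refine ((h₁.add h₂).const_add ((1 / 2) * (s - ψ) ^ 2)).congr_of_eventuallyEq
        (.of_forall fun t => ?_)
      simp only [F, Pi.add_apply, add_sub_right_comm y, add_assoc]
    have hinner : inner ℝ w w = (0 : ℝ) := by
      rw [← hmin_y.hasDerivAt_eq_zero hderiv]
      nth_rewrite 1 [hw]
      rw [inner_add_left, real_inner_smul_left]
      field_simp
    have hw0 : w = 0 := inner_self_eq_zero.mp hinner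
    have hm : m = ((M s + lam) / M s) • y := by
      rw [add_div, div_self hM.ne', add_smul, one_smul, ← sub_eq_zero, ← neg_eq_zero, ← hw0, hw]
      abel
    rw [hm, smul_smul, div_mul_div_cancel₀ (by positivity), div_self hM.ne', one_smul]
  refine ⟨hy, ?_⟩
  have hmin_s : IsLocalMin (fun t : ℝ => F (t, y)) s :=
    IsLocalMin.comp_continuous (f := F) (g := fun t : ℝ => (t, y)) (b := s) hloc (by fun_prop)
  have hderiv : HasDerivAt (fun t : ℝ => F (t, y))
      ((s - ψ) - lam * ‖y‖ ^ 2 * (2 * (1 - 2 * s)) / (2 * M s) ^ 2) s := by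
    have hsq := (((hasDerivAt_id' s).sub_const ψ).pow 2).const_mul (1 / 2)
    have hmob := ((hasDerivAt_id' s).mul ((hasDerivAt_id' s).const_sub 1)).const_mul 2
    have hquot := (hasDerivAt_const s (lam * ‖y‖ ^ 2)).div hmob
      (mul_ne_zero two_ne_zero hM.ne')
    refine ((hsq.add_const ((1 / 2) * ‖y - m‖ ^ 2)).add hquot).congr_deriv ?_
    simp only [M, Pi.mul_apply]
    ring
  have hcrit := hmin_s.hasDerivAt_eq_zero hderiv
  have hnorm : ‖y‖ ^ 2 = (M s / (M s + lam)) ^ 2 * ‖m‖ ^ 2 := by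
    rw [hy, norm_smul, mul_pow, Real.norm_eq_abs, sq_abs]
  have hMl : M s + lam ≠ 0 := by positivity
  have hM0 := hM.ne'
  rw [hnorm] at hcrit
  generalize M s = μ at *
  field_simp at hcrit
  linear_combination (1 / 2) * hcrit
end

section
/- Let λ > 0, d ≥ 1 an integer, m ∈ ℝ^d and ψ ∈ ℝ. Define M(s) = s(1−s) and the extended-real-valued transport cost D_M(s, y) = ‖y‖²/M(s) if M(s) > 0, D_M(s, y) = 0 if M(s) = 0 and y = 0, and D_M(s, y) = +∞ otherwise. (a) If ψ ≤ −‖m‖²/(2λ), then for all s ∈ ℝ and y ∈ ℝ^d: (1/2)ψ² + (1/2)‖m‖² ≤ (1/2)(s − ψ)² + (1/2)‖y − m‖² + (λ/2) D_M(s, y); that is, (0, 0) is a global minimizer of the proximal objective. (b) If ψ ≥ 1 + ‖m‖²/(2λ), then for all s ∈ ℝ and y ∈ ℝ^d: (1/2)(1 − ψ)² + (1/2)‖m‖² ≤ (1/2)(s − ψ)² + (1/2)‖y − m‖² + (λ/2) D_M(s, y); that is, (1, 0) is a global minimizer. -/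
open scoped Classical

/-- Extended-real-valued transport cost with degenerate mobility M(s) = s(1-s). -/
noncomputable def DMpsi (d : ℕ) (s : ℝ) (y : EuclideanSpace ℝ (Fin d)) : EReal :=
  if 0 < s * (1 - s) then (((‖y‖ ^ 2) / (s * (1 - s)) : ℝ) : EReal)
  else if s * (1 - s) = 0 ∧ y = 0 then 0
  else ⊤

/-- The transport cost is invariant under the reflection `s ↦ 1 - s`. -/
lemma DMpsi_one_sub (d : ℕ) (s : ℝ) (y : EuclideanSpace ℝ (Fin d)) :
    DMpsi d (1 - s) y = DMpsi d s y := by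
  have h : (1 - s) * (1 - (1 - s)) = s * (1 - s) := by ring
  simp only [DMpsi, h]

/-- A weighted Young inequality for the inner product. -/
lemma inner_le_weighted_sq {E : Type*} [NormedAddCommGroup E] [InnerProductSpace ℝ E]
    {lam s : ℝ} (hlam : 0 < lam) (hs : 0 < s) (y m : E) :
    inner ℝ y m ≤ s * (‖m‖ ^ 2 / (2 * lam)) + lam / 2 * (‖y‖ ^ 2 / s) := by
  have h : s * (‖m‖ ^ 2 / (2 * lam)) + lam / 2 * (‖y‖ ^ 2 / s) - ‖y‖ * ‖m‖
      = (s * ‖m‖ - lam * ‖y‖) ^ 2 / (2 * lam * s) := by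
    field_simp
    ring
  have h' : 0 ≤ (s * ‖m‖ - lam * ‖y‖) ^ 2 / (2 * lam * s) := by positivity
  linarith [real_inner_le_norm y m]

/-- The origin minimizes the proximal objective when `ψ ≤ -‖m‖² / (2 * lam)`. -/
lemma prox_objective_zero_le {lam : ℝ} (hlam : 0 < lam) {d : ℕ}
    {m : EuclideanSpace ℝ (Fin d)} {ψ : ℝ} (hψ : ψ ≤ -‖m‖ ^ 2 / (2 * lam))
    (s : ℝ) (y : EuclideanSpace ℝ (Fin d)) :
    (((1 / 2) * ψ ^ 2 + (1 / 2) * ‖m‖ ^ 2 : ℝ) : EReal) ≤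
      (((1 / 2) * (s - ψ) ^ 2 + (1 / 2) * ‖y - m‖ ^ 2 : ℝ) : EReal)
        + ((lam / 2 : ℝ) : EReal) * DMpsi d s y := by
  rw [neg_div] at hψ
  have hm : 0 ≤ ‖m‖ ^ 2 / (2 * lam) := by positivity
  unfold DMpsi
  split_ifs with hM h0
  · have hs : 0 < s := by nlinarith
    have hs1 : 0 < 1 - s := pos_of_mul_pos_right hM hs.le
    have hy : ‖y‖ ^ 2 / s ≤ ‖y‖ ^ 2 / (s * (1 - s)) := by
      apply div_le_div_of_nonneg_left (by positivity) hM
      nlinarith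
    rw [← EReal.coe_mul, ← EReal.coe_add, EReal.coe_le_coe_iff, norm_sub_sq_real]
    have hyoung := inner_le_weighted_sq hlam hs y m
    have hcost := mul_le_mul_of_nonneg_left hy (half_pos hlam).le
    have hshift := mul_le_mul_of_nonneg_left hψ hs.le
    nlinarith [sq_nonneg s, sq_nonneg ‖y‖]
  · obtain ⟨hs, rfl⟩ := h0
    rw [mul_zero, add_zero, EReal.coe_le_coe_iff, zero_sub, norm_neg]
    have hs0 : 0 ≤ s := by nlinarith [sq_nonneg s]
    nlinarith [mul_nonneg hs0 (by linarith : 0 ≤ -ψ), sq_nonneg s]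
  · rw [EReal.coe_mul_top_of_pos (half_pos hlam), EReal.coe_add_top]
    exact le_top

/-- Boundary cases of the proximal operator of the transport cost with degenerate
mobility: (0,0) resp. (1,0) is a global minimizer of the proximal objective when
ψ ≤ -‖m‖²/(2λ) resp. ψ ≥ 1 + ‖m‖²/(2λ). -/
theorem stmt_16 (lam : ℝ) (hlam : 0 < lam) (d : ℕ) (hd : 1 ≤ d)
    (m : EuclideanSpace ℝ (Fin d)) (ψ : ℝ) :
    (ψ ≤ -‖m‖ ^ 2 / (2 * lam) →
      ∀ (s : ℝ) (y : EuclideanSpace ℝ (Fin d)),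
        (((1 / 2) * ψ ^ 2 + (1 / 2) * ‖m‖ ^ 2 : ℝ) : EReal) ≤
          (((1 / 2) * (s - ψ) ^ 2 + (1 / 2) * ‖y - m‖ ^ 2 : ℝ) : EReal)
            + ((lam / 2 : ℝ) : EReal) * DMpsi d s y) ∧
    (ψ ≥ 1 + ‖m‖ ^ 2 / (2 * lam) →
      ∀ (s : ℝ) (y : EuclideanSpace ℝ (Fin d)),
        (((1 / 2) * (1 - ψ) ^ 2 + (1 / 2) * ‖m‖ ^ 2 : ℝ) : EReal) ≤
          (((1 / 2) * (s - ψ) ^ 2 + (1 / 2) * ‖y - m‖ ^ 2 : ℝ) : EReal)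
            + ((lam / 2 : ℝ) : EReal) * DMpsi d s y) := by
  refine ⟨fun hψ s y => prox_objective_zero_le hlam hψ s y, fun hψ s y => ?_⟩
  have hψ' : 1 - ψ ≤ -‖m‖ ^ 2 / (2 * lam) := by
    rw [neg_div]
    linarith
  have h := prox_objective_zero_le hlam hψ' (1 - s) y
  rwa [DMpsi_one_sub, show (1 - s - (1 - ψ)) ^ 2 = (s - ψ) ^ 2 by ring] at h
end
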